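/- arXiv:2404.18438 — 4 statements merged into one kernel-verified Lean document; each statement's English description precedes it below -/
import Mathlib

section
/- Let q ≥ 3 be an odd prime power, m ≥ 2 an integer, and N = q^m - 1. Then 4·|T_{(1,n)}| = q^m - (2-q)^m and 4·|T_{(0,n)}| = q^m + (2-q)^m - 2, where these are identities of integers (note (2-q)^m = (-1)^m (q-2)^m). -/
/-- The Hamming weight of a natural number in base `q`:
the number of nonzero base-`q` digits. -/
def hwt (q i : ℕ) : ℕ := ((Nat.digits q i).filter (· ≠ 0)).length

/-- For `q` odd, `m ≥ 2`, `N = q^m - 1` and `j ∈ {0,1}`, the set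
`T_{(j,n)} = { h : 1 ≤ h ≤ N-1, h odd, wt(h) ≡ j (mod 2) }`. -/
def Tset (q m j : ℕ) : Finset ℕ :=
  (Finset.Icc 1 (q ^ m - 1 - 1)).filter (fun h => h % 2 = 1 ∧ hwt q h % 2 = j)

open Finset in
theorem Finset.sum_range_mul_eq_sum_sum {M : Type*} [AddCommMonoid M] (f : ℕ → M) (q n : ℕ) :
    ∑ h ∈ range (q * n), f h = ∑ k ∈ range n, ∑ d ∈ range q, f (q * k + d) := by
  induction n with
  | zero => simp
  | succ n ih => rw [Nat.mul_succ, sum_range_add, ih, sum_range_succ]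

theorem hwt_zero (q : ℕ) : hwt q 0 = 0 := by simp [hwt]

theorem hwt_eq_add_hwt_div {q : ℕ} (hq : 1 < q) (n : ℕ) :
    hwt q n = (if n % q = 0 then 0 else 1) + hwt q (n / q) := by
  rcases eq_or_ne n 0 with rfl | hn
  · simp [hwt_zero]
  · unfold hwt
    rw [Nat.digits_eq_cons_digits_div hq hn]
    split_ifs with h <;> simp [h, add_comm]

theorem hwt_mul_add {q d : ℕ} (hq : 1 < q) (k : ℕ) (hd : d < q) :
    hwt q (q * k + d) = (if d = 0 then 0 else 1) + hwt q k := by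
  rw [hwt_eq_add_hwt_div hq, Nat.mul_add_mod, Nat.mod_eq_of_lt hd,
    Nat.mul_add_div (by omega), Nat.div_eq_of_lt hd, add_zero]

open Finset in
theorem sum_range_pow_mul_pow_hwt {R : Type*} [CommRing R] {q : ℕ} (hq : 1 < q) {x : R}
    (hx : x ^ q = x) (y : R) (m : ℕ) :
    ∑ h ∈ range (q ^ m), x ^ h * y ^ hwt q h =
      (1 - y + y * ∑ d ∈ range q, x ^ d) ^ m := by
  have digit_sum : ∑ d ∈ range q, x ^ d * y ^ (if d = 0 then 0 else 1) =
      1 - y + y * ∑ d ∈ range q, x ^ d := by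
    obtain ⟨r, rfl⟩ : ∃ r, q = r + 1 := ⟨q - 1, by omega⟩
    simp only [sum_range_succ', Nat.succ_ne_zero, if_true, if_false, pow_one, pow_zero,
      ← sum_mul]
    ring
  induction m with
  | zero => simp [hwt_zero]
  | succ m ih =>
    rw [pow_succ', sum_range_mul_eq_sum_sum, pow_succ, ← ih, ← digit_sum, sum_mul_sum]
    refine sum_congr rfl fun k _ => sum_congr rfl fun d hd => ?_
    rw [hwt_mul_add hq k (mem_range.mp hd), pow_add, pow_add, pow_mul, hx]
    ring

open Finset in
theorem Tset_eq_filter_range {q : ℕ} (hodd : Odd q) (m j : ℕ) :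
    Tset q m j = (range (q ^ m)).filter (fun h => h % 2 = 1 ∧ hwt q h % 2 = j) := by
  have hqm := Nat.odd_iff.mp (hodd.pow (n := m))
  ext h
  simp only [Tset, mem_filter, mem_Icc, mem_range]
  constructor <;> rintro ⟨h₁, h₂, h₃⟩ <;> exact ⟨by omega, h₂, h₃⟩

open Finset in
/-- The indicator of `Tset q m j` is `(1 - (-1) ^ h) * (1 + (-1) ^ (j + hwt q h)) / 4`. -/
theorem four_mul_card_Tset {q : ℕ} (hodd : Odd q) (m : ℕ) {j : ℕ} (hj : j < 2) :
    (4 : ℤ) * (Tset q m j).card =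
      ∑ h ∈ range (q ^ m), (1 - (-1) ^ h) * (1 + (-1) ^ j * (-1) ^ hwt q h) := by
  rw [Tset_eq_filter_range hodd, card_filter, Nat.cast_sum, mul_sum]
  refine sum_congr rfl fun h _ => ?_
  interval_cases j <;> rcases Nat.even_or_odd h with hh | hh <;>
    rcases Nat.even_or_odd (hwt q h) with hw | hw <;>
    simp [hh.neg_one_pow, hw.neg_one_pow, Nat.even_iff.mp, Nat.odd_iff.mp, hh, hw]

/-- Let `q ≥ 3` be an odd prime power and `m ≥ 2`. Then
`4·|T_{(1,n)}| = q^m - (2-q)^m` and `4·|T_{(0,n)}| = q^m + (2-q)^m - 2`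
as identities of integers. -/
theorem stmt2 (q m : ℕ) (hq : 3 ≤ q) (hodd : Odd q) (hpp : IsPrimePow q)
    (hm : 2 ≤ m) :
    (4 : ℤ) * (Tset q m 1).card = (q : ℤ) ^ m - (2 - (q : ℤ)) ^ m ∧
    (4 : ℤ) * (Tset q m 0).card = (q : ℤ) ^ m + (2 - (q : ℤ)) ^ m - 2 := by
  have hq' : 1 < q := by omega
  have sum_sign : ∑ h ∈ Finset.range (q ^ m), (-1 : ℤ) ^ h = 1 := by
    rw [neg_one_geom_sum, if_neg (Nat.not_even_iff_odd.mpr hodd.pow)]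
  have sum_wt : ∑ h ∈ Finset.range (q ^ m), (-1 : ℤ) ^ hwt q h = (2 - (q : ℤ)) ^ m := by
    have := sum_range_pow_mul_pow_hwt hq' (one_pow q) (-1 : ℤ) m
    simp only [one_pow, one_mul, Finset.sum_const, Finset.card_range, nsmul_eq_mul] at this
    rw [this]
    ring
  have sum_sign_wt :
      ∑ h ∈ Finset.range (q ^ m), (-1 : ℤ) ^ h * (-1) ^ hwt q h = 1 := by
    rw [sum_range_pow_mul_pow_hwt hq' hodd.neg_one_pow, neg_one_geom_sum,
      if_neg (Nat.not_even_iff_odd.mpr hodd)]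
    norm_num
  have card_formula (c : ℤ) :
      ∑ h ∈ Finset.range (q ^ m), (1 - (-1 : ℤ) ^ h) * (1 + c * (-1) ^ hwt q h) =
        (q : ℤ) ^ m - 1 + c * (2 - (q : ℤ)) ^ m - c := by
    have expand (h : ℕ) : (1 - (-1 : ℤ) ^ h) * (1 + c * (-1) ^ hwt q h) =
        1 - (-1) ^ h + c * (-1) ^ hwt q h - c * ((-1) ^ h * (-1) ^ hwt q h) := by ring
    simp only [expand, Finset.sum_sub_distrib, Finset.sum_add_distrib, ← Finset.mul_sum,
      sum_sign, sum_wt, sum_sign_wt]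
    simp
  constructor
  · rw [four_mul_card_Tset hodd m one_lt_two, card_formula]
    ring
  · rw [four_mul_card_Tset hodd m two_pos, card_formula]
    ring
end

section
/- Let q ≥ 3 be an odd prime power, m ≥ 3 an odd integer, h = (m-1)/2, and set ε = 0 if q = 3 and ε = q - 2 if q ≥ 5. Then for every integer i with -ε ≤ i ≤ q^h - 1, the integer (q-2)·q^{2h} + (q^h + 1)·i is an odd positive integer at most q^m - 2 whose Hamming weight (in base q) is odd; that is, it belongs to T_{(1,n)}. -/
theorem hwt_add_mul {q d : ℕ} (hq : 2 ≤ q) (hd : d < q) (n : ℕ) :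
    hwt q (d + q * n) = (if d = 0 then 0 else 1) + hwt q n := by
  by_cases h0 : d = 0 ∧ n = 0
  · obtain ⟨rfl, rfl⟩ := h0
    simp [hwt]
  · have hne : d ≠ 0 ∨ n ≠ 0 := by tauto
    unfold hwt
    rw [Nat.digits_add q (by omega) d n hd hne, List.filter_cons]
    by_cases h : d = 0 <;> simp [h, add_comm]

theorem hwt_of_pos_of_lt {q d : ℕ} (hq : 2 ≤ q) (hd0 : 0 < d) (hd : d < q) : hwt q d = 1 := by
  simpa [hwt_zero, hd0.ne'] using hwt_add_mul hq hd 0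

theorem hwt_add_pow_mul {q : ℕ} (hq : 2 ≤ q) (b k : ℕ) :
    ∀ a < q ^ k, hwt q (a + q ^ k * b) = hwt q a + hwt q b := by
  induction k with
  | zero =>
    intro a ha
    obtain rfl : a = 0 := by simpa using ha
    simp [hwt_zero]
  | succ k ih =>
    intro a ha
    have hmod : a % q < q := Nat.mod_lt _ (by omega)
    have hdiv : a / q < q ^ k := Nat.div_lt_of_lt_mul (by rwa [pow_succ'] at ha)
    have hsplit : a + q ^ (k + 1) * b = a % q + q * (a / q + q ^ k * b) := by
      conv_lhs => rw [← Nat.mod_add_div a q]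
      ring
    rw [hsplit, hwt_add_mul hq hmod, ih _ hdiv]
    conv_rhs => rw [← Nat.mod_add_div a q, hwt_add_mul hq hmod]
    ring

theorem hwt_pow_sub_one {q : ℕ} (hq : 2 ≤ q) (k : ℕ) : hwt q (q ^ k - 1) = k := by
  induction k with
  | zero => simp [hwt_zero]
  | succ k ih =>
    have hk : 1 ≤ q ^ k := Nat.one_le_pow _ _ (by omega)
    have hsplit : q ^ (k + 1) - 1 = (q - 1) + q * (q ^ k - 1) := by
      rw [pow_succ', Nat.mul_sub_one]
      have := Nat.le_mul_of_pos_right q hk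
      omega
    rw [hsplit, hwt_add_mul hq (by omega), ih, if_neg (by omega), add_comm]

theorem hwt_pow_sub {q j k : ℕ} (hj0 : 0 < j) (hj : j < q) (hk : 0 < k) :
    hwt q (q ^ k - j) = k := by
  obtain ⟨k, rfl⟩ := Nat.exists_eq_succ_of_ne_zero hk.ne'
  have hk : 1 ≤ q ^ k := Nat.one_le_pow _ _ (by omega)
  have hsplit : q ^ (k + 1) - j = (q - j) + q * (q ^ k - 1) := by
    rw [pow_succ', Nat.mul_sub_one]
    have := Nat.le_mul_of_pos_right q hk
    omega
  rw [Nat.succ_eq_add_one, hsplit, hwt_add_mul (by omega) (by omega), hwt_pow_sub_one (by omega),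
    if_neg (by omega), add_comm]

theorem hwt_three_blocks {q k a b c : ℕ} (hq : 2 ≤ q) (ha : a < q ^ k) (hb : b < q ^ k) :
    hwt q (a + q ^ k * (b + q ^ k * c)) = hwt q a + (hwt q b + hwt q c) := by
  rw [hwt_add_pow_mul hq _ k a ha, hwt_add_pow_mul hq _ k b hb]

/-- Let `q ≥ 3` be an odd prime power, `m ≥ 3` odd, `h = (m-1)/2` and
`ε = 0` if `q = 3`, `ε = q - 2` if `q ≥ 5`. Then for every integer `i` with
`-ε ≤ i ≤ q^h - 1`, the integer `(q-2)·q^{2h} + (q^h + 1)·i` is an odd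
positive integer at most `q^m - 2` whose Hamming weight in base `q` is odd;
that is, it belongs to `T_{(1,n)}`. -/
theorem stmt5 (q m : ℕ) (hq : 3 ≤ q) (hodd : Odd q) (hpp : IsPrimePow q)
    (hm : 3 ≤ m) (hmo : Odd m) (h : ℕ) (hh : h = (m - 1) / 2)
    (ε : ℕ) (hε : ε = if q = 3 then 0 else q - 2)
    (i : ℤ) (hi1 : -(ε : ℤ) ≤ i) (hi2 : i ≤ (q : ℤ) ^ h - 1) :
    ∀ x : ℤ, x = ((q : ℤ) - 2) * (q : ℤ) ^ (2 * h) + ((q : ℤ) ^ h + 1) * i →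
      Odd x ∧ 1 ≤ x ∧ x ≤ (q : ℤ) ^ m - 2 ∧ Odd (hwt q x.toNat) := by
  rintro x hx
  obtain ⟨t, rfl⟩ := hmo
  have ht : h = t := by omega
  subst ht
  have hh0 : 0 < h := by omega
  have hqh : q ≤ q ^ h := Nat.le_self_pow hh0.ne' q
  have hoddx : Odd x := by
    have hqz : Odd (q : ℤ) := by exact_mod_cast hodd
    rw [hx]
    exact ((hqz.sub_even even_two).mul hqz.pow).add_even ((hqz.pow.add_one).mul_right i)
  suffices H : ∃ a b c : ℕ, a < q ^ h ∧ b < q ^ h ∧ 0 < c ∧ c ≤ q - 2 ∧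
      x = a + (q : ℤ) ^ h * (b + (q : ℤ) ^ h * c) ∧ Even (hwt q a + hwt q b) by
    obtain ⟨a, b, c, ha, hb, hc0, hc, hxe, he⟩ := H
    have hxn : x = ((a + q ^ h * (b + q ^ h * c) : ℕ) : ℤ) := by
      rw [hxe]
      push_cast
      rfl
    have hlt : a + q ^ h * (b + q ^ h * c) + 2 ≤ q ^ (2 * h + 1) := by
      have hpow : q ^ (2 * h + 1) = q ^ h * (q ^ h * q) := by ring
      obtain ⟨r, rfl⟩ : ∃ r, q = r + 2 := ⟨q - 2, by omega⟩
      generalize (r + 2) ^ h = Q at *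
      rw [hpow]
      have h1 : c ≤ r := hc
      have h2 : Q * c ≤ Q * r := Nat.mul_le_mul_left _ h1
      have h3 : Q * (b + Q * c + 1) ≤ Q * (Q * (r + 1)) := by
        apply Nat.mul_le_mul_left
        rw [mul_add]
        omega
      nlinarith
    have hpos : 1 ≤ a + q ^ h * (b + q ^ h * c) := by
      have : 0 < q ^ h * (b + q ^ h * c) := by positivity
      omega
    refine ⟨hoddx, ?_, ?_, ?_⟩
    · rw [hxn]
      exact_mod_cast hpos
    · rw [hxn, le_sub_iff_add_le]
      exact_mod_cast hlt
    · rw [hxn, Int.toNat_natCast, hwt_three_blocks (by omega) ha hb,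
        hwt_of_pos_of_lt (by omega) hc0 (by omega), ← add_assoc]
      exact he.add_one
  have hq2 : ((q - 2 : ℕ) : ℤ) = q - 2 := by omega
  rcases le_or_gt 0 i with hi | hi
  · lift i to ℕ using hi
    have hiq : i < q ^ h := by
      have : (i : ℤ) < (q : ℤ) ^ h := by omega
      exact_mod_cast this
    refine ⟨i, i, q - 2, hiq, hiq, by omega, le_rfl, ?_, Even.add_self _⟩
    rw [hx, hq2]
    ring
  · obtain ⟨j, rfl⟩ : ∃ j : ℕ, i = -j := ⟨(-i).toNat, by omega⟩
    split_ifs at hε with h3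
    · omega
    have hj0 : 0 < j := by omega
    have hj : j + 1 < q := by omega
    have hq3 : ((q - 3 : ℕ) : ℤ) = q - 3 := by omega
    refine ⟨q ^ h - j, q ^ h - (j + 1), q - 3, by omega, by omega, by omega, by omega, ?_, ?_⟩
    · have h1 : j ≤ q ^ h := by omega
      have h2 : j + 1 ≤ q ^ h := by omega
      rw [hx, hq3, Nat.cast_sub h1, Nat.cast_sub h2]
      push_cast
      ring
    · rw [hwt_pow_sub hj0 (by omega) hh0, hwt_pow_sub (by omega) hj hh0]
      exact Even.add_self h
end

section
/- Let q = 3, let m ≥ 4 be an integer with m ≡ 0 (mod 4), let N = 3^m - 1, n = (3^m - 1)/2, h = (m-2)/2, b = 3^{m-1} - 4·(3^h - 1), and v = n + 3^h - 1. Then for every integer i with 1 ≤ i ≤ (3^h + 13)/2, the integer (b + v·i) mod N is odd and its Hamming weight (in base 3) is odd; that is, it belongs to T_{(1,n)}. -/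
lemma hwt_three_mul_add (a d : ℕ) (hd : d < 3) :
    hwt 3 (3 * a + d) = hwt 3 a + if d = 0 then 0 else 1 := by
  by_cases h0 : 3 * a + d = 0
  · obtain rfl : a = 0 := by omega
    obtain rfl : d = 0 := by omega
    simp
  · have e := Nat.digits_def' (b := 3) (by norm_num) (Nat.pos_of_ne_zero h0)
    rw [show (3 * a + d) % 3 = d by omega, show (3 * a + d) / 3 = a by omega] at e
    unfold hwt
    rw [e]
    by_cases hd0 : d = 0 <;> simp [hd0]

lemma hwt_mul_pow_add (h a l : ℕ) (hl : l < 3 ^ h) :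
    hwt 3 (a * 3 ^ h + l) = hwt 3 a + hwt 3 l := by
  induction h generalizing l with
  | zero =>
    obtain rfl : l = 0 := by simpa using hl
    simp [hwt]
  | succ h ih =>
    obtain ⟨q, d, hd, rfl⟩ : ∃ q d, d < 3 ∧ l = 3 * q + d :=
      ⟨l / 3, l % 3, Nat.mod_lt _ (by norm_num), by omega⟩
    have hq : q < 3 ^ h := by rw [pow_succ] at hl; omega
    rw [show a * 3 ^ (h + 1) + (3 * q + d) = 3 * (a * 3 ^ h + q) + d by ring,
      hwt_three_mul_add _ _ hd, hwt_three_mul_add _ _ hd, ih q hq]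
    ring

/-- Complementing all `h` ternary digits exchanges `0` and `2`, so the joint weight has the parity
of `h` plus the number of digits equal to `1`. -/
lemma hwt_add_hwt_compl_mod_two (h a b : ℕ) (hab : a + b + 1 = 3 ^ h) :
    (hwt 3 a + hwt 3 b) % 2 = (h + a) % 2 := by
  induction h generalizing a b with
  | zero =>
    obtain ⟨rfl, rfl⟩ : a = 0 ∧ b = 0 := by
      rw [pow_zero] at hab
      omega
    simp [hwt]
  | succ h ih =>
    obtain ⟨q, d, hd, rfl⟩ : ∃ q d, d < 3 ∧ a = 3 * q + d :=
      ⟨a / 3, a % 3, Nat.mod_lt _ (by norm_num), by omega⟩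
    obtain ⟨r, e, he, rfl⟩ : ∃ r e, e < 3 ∧ b = 3 * r + e :=
      ⟨b / 3, b % 3, Nat.mod_lt _ (by norm_num), by omega⟩
    rw [pow_succ] at hab
    have := ih q r (by omega)
    rw [hwt_three_mul_add _ _ hd, hwt_three_mul_add _ _ he]
    split_ifs <;> omega

lemma hwt_one : hwt 3 1 = 1 := by simp [hwt]

lemma hwt_two : hwt 3 2 = 1 := by simp [hwt]

lemma hwt_pow_sub_two_mod_two (h r : ℕ) (hr : r + 2 = 3 ^ h) : hwt 3 r % 2 = h % 2 := by
  have := hwt_add_hwt_compl_mod_two h 1 r (by omega)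
  rw [hwt_one] at this
  omega

/-- The number `c * 9 ^ h + (3 ^ h - 1) * K` with `1 ≤ K ≤ 3 ^ h` has the digits of `c`, then those
of `K - 1`, then those of the complement of `K - 1`. -/
lemma hwt_mul_sq_add_mod_two (h c a b : ℕ) (hab : a + b + 1 = 3 ^ h) :
    hwt 3 ((c * 3 ^ h + a) * 3 ^ h + b) % 2 = (hwt 3 c + h + a) % 2 := by
  rw [hwt_mul_pow_add h _ b (by omega), hwt_mul_pow_add h _ a (by omega)]
  have := hwt_add_hwt_compl_mod_two h a b hab
  omega

lemma odd_and_mem_of_emod_eq {N z x t : ℤ} (Y : ℕ) (hY : Odd (Y : ℤ))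
    (hlt : (Y : ℤ) < N) (hz : z = Y + N * t) (hx : x = z % N) (hw : hwt 3 Y % 2 = 1) :
    Odd x ∧ 1 ≤ x ∧ x ≤ N - 1 ∧ Odd (hwt 3 x.toNat) := by
  have hxY : x = Y := by
    rw [hx, hz, Int.add_mul_emod_self_left, Int.emod_eq_of_lt (by positivity) hlt]
  subst hxY
  have := hY
  rw [Int.odd_iff] at this
  refine ⟨hY, by omega, by omega, ?_⟩
  rw [Int.toNat_natCast, Nat.odd_iff]
  exact hw

lemma odd_and_mem_of_even_index (t u : ℕ) (hu : 3 ^ (2 * t + 1) = 4 * u + 3) (hu6 : 6 ≤ u)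
    (N x j : ℤ)
    (hN : N = 2 * (72 * u ^ 2 + 108 * u + 40)) (hj0 : 1 ≤ j) (hju : j ≤ u + 4)
    (hx : x = (3 * (4 * u + 3) ^ 2 - 4 * (4 * u + 3 - 1) +
      (72 * u ^ 2 + 108 * u + 40 + (4 * u + 3) - 1) * (2 * j)) % N) :
    Odd x ∧ 1 ≤ x ∧ x ≤ N - 1 ∧ Odd (hwt 3 x.toNat) := by
  have hu6Z : (6 : ℤ) ≤ u := by exact_mod_cast hu6
  rcases (by omega : j = 1 ∨ j = 2 ∨ 3 ≤ j) with rfl | rfl | hj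
  · refine odd_and_mem_of_emod_eq (t := 1)
      ((2 * (4 * u + 3) + (4 * u + 1)) * (4 * u + 3) + 2) ?_ ?_ ?_ hx ?_
    · rw [Int.odd_iff]; push_cast; ring_nf; omega
    · rw [hN]; push_cast; nlinarith
    · rw [hN]; push_cast; ring
    · have := hwt_pow_sub_two_mod_two (2 * t + 1) (4 * u + 1) (by omega)
      rw [← hu, hwt_mul_pow_add _ _ _ (by omega), hwt_mul_pow_add _ _ _ (by omega), hwt_two]
      omega
  · refine odd_and_mem_of_emod_eq (t := 2)
      ((3 * (4 * u + 3) + 0) * (4 * u + 3) + 0) ?_ ?_ ?_ hx ?_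
    · rw [Int.odd_iff]; push_cast; ring_nf; omega
    · rw [hN]; push_cast; nlinarith
    · rw [hN]; push_cast; ring
    · rw [← hu, hwt_mul_pow_add _ _ _ (by omega), hwt_mul_pow_add _ _ _ (by omega)]
      simp [hwt]
  · obtain ⟨k, rfl⟩ : ∃ k : ℕ, j = k + 3 := ⟨(j - 3).toNat, by omega⟩
    obtain ⟨r, hr⟩ : ∃ r, 2 * k + 1 + r + 1 = 4 * u + 3 := ⟨4 * u + 1 - 2 * k, by omega⟩
    have hrZ : (r : ℤ) = 4 * u + 1 - 2 * k := by omega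
    refine odd_and_mem_of_emod_eq (t := k + 3)
      ((3 * (4 * u + 3) + (2 * k + 1)) * (4 * u + 3) + r) ?_ ?_ ?_ hx ?_
    · rw [Int.odd_iff]; push_cast; rw [hrZ]; ring_nf; omega
    · have hku := mul_le_mul_of_nonneg_right (by omega : (k : ℤ) ≤ u + 1)
        (by positivity : (0 : ℤ) ≤ u)
      rw [hN]; push_cast; rw [hrZ]; nlinarith
    · rw [hN]; push_cast; rw [hrZ]; ring
    · have := hwt_mul_sq_add_mod_two (2 * t + 1) 3 (2 * k + 1) r (by omega)
      have w3 : hwt 3 3 = 1 := by simp [hwt]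
      rw [← hu, this, w3]
      omega

lemma odd_and_mem_of_odd_index (t u : ℕ) (hu : 3 ^ (2 * t + 1) = 4 * u + 3) (hu6 : 6 ≤ u)
    (N x j : ℤ)
    (hN : N = 2 * (72 * u ^ 2 + 108 * u + 40)) (hj0 : 0 ≤ j) (hju : j ≤ u + 3)
    (hx : x = (3 * (4 * u + 3) ^ 2 - 4 * (4 * u + 3 - 1) +
      (72 * u ^ 2 + 108 * u + 40 + (4 * u + 3) - 1) * (2 * j + 1)) % N) :
    Odd x ∧ 1 ≤ x ∧ x ≤ N - 1 ∧ Odd (hwt 3 x.toNat) := by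
  have hu6Z : (6 : ℤ) ≤ u := by exact_mod_cast hu6
  have w7 : hwt 3 7 = 2 := by simp [hwt]
  have w8 : hwt 3 8 = 2 := by simp [hwt]
  rcases (by omega : j = u + 3 ∨ j ≤ u + 2) with rfl | hj
  · refine odd_and_mem_of_emod_eq (t := u + 3)
      ((8 * (4 * u + 3) + 0) * (4 * u + 3) + (4 * u + 1)) ?_ ?_ ?_ hx ?_
    · rw [Int.odd_iff]; push_cast; ring_nf; omega
    · rw [hN]; push_cast; nlinarith
    · rw [hN]; push_cast; ring
    · have := hwt_pow_sub_two_mod_two (2 * t + 1) (4 * u + 1) (by omega)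
      rw [← hu, hwt_mul_pow_add _ _ _ (by omega), hwt_mul_pow_add _ _ _ (by omega), w8]
      simp only [hwt, Nat.digits_zero, List.filter_nil, List.length_nil] at this ⊢
      omega
  · obtain ⟨k, rfl⟩ : ∃ k : ℕ, j = k := ⟨j.toNat, by omega⟩
    obtain ⟨a, ha⟩ : ∃ a, a + 2 = 2 * u + 2 * k := ⟨2 * u + 2 * k - 2, by omega⟩
    obtain ⟨r, hr⟩ : ∃ r, r + 2 * k = 2 * u + 4 := ⟨2 * u + 4 - 2 * k, by omega⟩
    have haZ : (a : ℤ) = 2 * u + 2 * k - 2 := by omega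
    have hrZ : (r : ℤ) = 2 * u + 4 - 2 * k := by omega
    refine odd_and_mem_of_emod_eq (t := k)
      ((7 * (4 * u + 3) + a) * (4 * u + 3) + r) ?_ ?_ ?_ hx ?_
    · rw [Int.odd_iff]; push_cast; rw [haZ, hrZ]; ring_nf; omega
    · have hku := mul_le_mul_of_nonneg_right hj (by positivity : (0 : ℤ) ≤ u)
      rw [hN]; push_cast; rw [haZ, hrZ]; nlinarith
    · rw [hN]; push_cast; rw [haZ, hrZ]; ring
    · have := hwt_mul_sq_add_mod_two (2 * t + 1) 7 a r (by omega)
      rw [← hu, this, w7]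
      omega

/-- Let `q = 3`, `m ≥ 4` with `m ≡ 0 (mod 4)`, `N = 3^m - 1`,
`n = (3^m - 1)/2`, `h = (m-2)/2`, `b = 3^{m-1} - 4·(3^h - 1)` and
`v = n + 3^h - 1`. Then for every integer `i` with `1 ≤ i ≤ (3^h + 13)/2`,
the integer `(b + v·i) mod N` is odd, lies in `{1, …, N-1}`, and its Hamming
weight in base `3` is odd; that is, it belongs to `T_{(1,n)}`. -/
theorem stmt10 (m : ℕ) (hm : 4 ≤ m) (hm4 : m % 4 = 0)
    (N : ℤ) (hN : N = (3 : ℤ) ^ m - 1) (n : ℤ) (hn : n = ((3 : ℤ) ^ m - 1) / 2)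
    (h : ℕ) (hh : h = (m - 2) / 2)
    (b v : ℤ) (hb : b = (3 : ℤ) ^ (m - 1) - 4 * ((3 : ℤ) ^ h - 1))
    (hv : v = n + (3 : ℤ) ^ h - 1)
    (i : ℤ) (hi1 : 1 ≤ i) (hi2 : i ≤ ((3 : ℤ) ^ h + 13) / 2) :
    ∀ x : ℤ, x = (b + v * i) % N →
      Odd x ∧ 1 ≤ x ∧ x ≤ N - 1 ∧ Odd (hwt 3 x.toNat) := by
  intro x hx
  obtain ⟨t, rfl⟩ : ∃ t, m = 4 * t + 4 := ⟨m / 4 - 1, by omega⟩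
  obtain rfl : h = 2 * t + 1 := by omega
  rcases Nat.eq_zero_or_pos t with rfl | ht
  · norm_num at hN hn hb hv hi2
    subst hn hN hb hv
    have h2 : hwt 3 61 = 3 ∧ hwt 3 23 = 3 ∧ hwt 3 65 = 3 ∧ hwt 3 27 = 1 ∧ hwt 3 69 = 3 ∧
        hwt 3 31 = 3 ∧ hwt 3 73 = 3 ∧ hwt 3 35 = 3 := by
      simp [hwt]
    interval_cases i <;> norm_num at hx <;> subst hx <;> simp [h2] <;> decide
  · obtain ⟨u, hu⟩ : ∃ u : ℕ, 3 ^ (2 * t + 1) = 4 * u + 3 := by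
      have : (3 ^ (2 * t + 1)) % 4 = 3 := by
        rw [pow_succ, pow_mul, Nat.mul_mod, Nat.pow_mod]
        norm_num
      exact ⟨3 ^ (2 * t + 1) / 4, by omega⟩
    have hu6 : 6 ≤ u := by
      have : 3 ^ 3 ≤ 3 ^ (2 * t + 1) := Nat.pow_le_pow_right (by norm_num) (by omega)
      omega
    have huZ : (3 : ℤ) ^ (2 * t + 1) = 4 * u + 3 := by exact_mod_cast hu
    have e4 : (3 : ℤ) ^ (4 * t + 4) = 9 * (4 * u + 3) ^ 2 := by rw [← huZ]; ring
    have e3 : (3 : ℤ) ^ (4 * t + 4 - 1) = 3 * (4 * u + 3) ^ 2 := by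
      rw [show 4 * t + 4 - 1 = 4 * t + 3 by omega, ← huZ]; ring
    have hNn : N = 2 * n := by
      rw [hN, hn, e4]
      ring_nf
      omega
    rw [e4] at hN
    rw [e3, huZ] at hb
    rw [huZ] at hv hi2
    have hn' : n = 72 * u ^ 2 + 108 * u + 40 := by nlinarith
    rcases Int.even_or_odd' i with ⟨j, rfl | rfl⟩
    · exact odd_and_mem_of_even_index t u hu hu6 N x j (by rw [hNn, hn']) (by omega) (by omega)
        (by rw [hx, hb, hv, hn'])
    · exact odd_and_mem_of_odd_index t u hu hu6 N x j (by rw [hNn, hn']) (by omega) (by omega)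
        (by rw [hx, hb, hv, hn'])
end

section
/- Let q ≥ 3 be a prime power and m ≥ 3 odd. Then: (1) for every 0 ≤ ℓ ≤ (m-3)/2 and every integer i with 0 ≤ i ≤ 2q^ℓ - 1, wt_q(2q^ℓ - 1 + (q^{(m+1)/2} - 1)·i) = 1 + (q-1)ℓ; (2) for ℓ = (m-1)/2 and every integer i with 1 ≤ i ≤ q^ℓ, wt_q(q^{m-1} + (q^{(m-1)/2} - 1)·i) = 1 + (q-1)ℓ; (3) for every (m+1)/2 ≤ ℓ ≤ m - 1 and every integer i with 0 ≤ i ≤ (q-1)·q^{m-1-ℓ} - 1, wt_q(q^m - (q-1)·q^{m-1-ℓ} - (q^{(m+1)/2} - 1)·i) = 1 + (q-1)ℓ. In particular all these integers lie in T_{(q,m,ℓ)}. -/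
/-- The `q`-weight of a natural number: the sum of its base-`q` digits. -/
def wtq (q i : ℕ) : ℕ := (Nat.digits q i).sum

theorem wtq_add_mul {q r : ℕ} (hq : 2 ≤ q) (hr : r < q) (a : ℕ) :
    wtq q (r + q * a) = r + wtq q a := by
  unfold wtq
  by_cases h : r = 0 ∧ a = 0
  · simp [h.1, h.2]
  · rw [Nat.digits_add q (by omega) r a hr (by tauto), List.sum_cons]

theorem wtq_of_lt {q r : ℕ} (hq : 2 ≤ q) (hr : r < q) : wtq q r = r := by
  simpa [wtq] using wtq_add_mul hq hr 0

theorem wtq_add_pow_mul {q : ℕ} (hq : 2 ≤ q) (k : ℕ) :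
    ∀ c a : ℕ, c < q ^ k → wtq q (c + q ^ k * a) = wtq q c + wtq q a := by
  induction k with
  | zero =>
    intro c a hc
    obtain rfl : c = 0 := by simpa using hc
    simp [wtq]
  | succ k ih =>
    intro c a hc
    have hr : c % q < q := Nat.mod_lt _ (by omega)
    have hc' : c / q < q ^ k := Nat.div_lt_of_lt_mul (by rwa [← pow_succ'])
    have hsplit : c + q ^ (k + 1) * a = c % q + q * (c / q + q ^ k * a) := by
      conv_lhs => rw [← Nat.mod_add_div c q]
      ring
    have hwc : wtq q c = c % q + wtq q (c / q) := by
      rw [← wtq_add_mul hq hr, Nat.mod_add_div]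
    rw [hsplit, wtq_add_mul hq hr, ih _ _ hc', hwc, add_assoc]

/-- Two numbers adding up to `d * q ^ k - 1` are added without carries. -/
theorem wtq_add_wtq_of_add_eq {q d : ℕ} (hq : 2 ≤ q) (hd : d ≤ q) (k : ℕ) :
    ∀ a b : ℕ, a + b + 1 = d * q ^ k → wtq q a + wtq q b + 1 = (q - 1) * k + d := by
  induction k with
  | zero =>
    intro a b h
    rw [pow_zero, mul_one] at h
    rw [wtq_of_lt hq (by omega), wtq_of_lt hq (by omega)]
    omega
  | succ k ih =>
    intro a b h
    have hr : b % q < q := Nat.mod_lt _ (by omega)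
    have hb := Nat.mod_add_div b q
    have hlt : b / q < d * q ^ k := Nat.div_lt_of_lt_mul (by
      have : d * q ^ (k + 1) = q * (d * q ^ k) := by ring
      omega)
    obtain ⟨a', ha'⟩ := Nat.exists_eq_add_of_lt hlt
    have ha : a = (q - 1 - b % q) + q * a' := by
      have h1 : d * q ^ (k + 1) = q * (b / q) + q * a' + q := by
        rw [pow_succ, ← mul_assoc, ha']
        ring
      omega
    have hwb : wtq q b = b % q + wtq q (b / q) := by
      rw [← wtq_add_mul hq hr, Nat.mod_add_div]
    have := ih a' (b / q) (by omega)
    rw [ha, wtq_add_mul hq (by omega), hwb, mul_add, mul_one]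
    omega

/-- Let `q ≥ 3` be a prime power and `m ≥ 3` odd. Then:
(1) for `0 ≤ ℓ ≤ (m-3)/2` and `0 ≤ i ≤ 2q^ℓ - 1`,
    `wt_q(2q^ℓ - 1 + (q^{(m+1)/2} - 1)·i) = 1 + (q-1)ℓ`;
(2) for `ℓ = (m-1)/2` and `1 ≤ i ≤ q^ℓ`,
    `wt_q(q^{m-1} + (q^{(m-1)/2} - 1)·i) = 1 + (q-1)ℓ`;
(3) for `(m+1)/2 ≤ ℓ ≤ m - 1` and `0 ≤ i ≤ (q-1)q^{m-1-ℓ} - 1`,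
    `wt_q(q^m - (q-1)q^{m-1-ℓ} - (q^{(m+1)/2} - 1)·i) = 1 + (q-1)ℓ`.
In particular all these integers lie in `T_{(q,m,ℓ)}`. -/
theorem stmt13 (q m : ℕ) (hq : 3 ≤ q) (hpp : IsPrimePow q)
    (hm : 3 ≤ m) (hmo : Odd m) :
    (∀ l i : ℕ, l ≤ (m - 3) / 2 → i ≤ 2 * q ^ l - 1 →
      wtq q (2 * q ^ l - 1 + (q ^ ((m + 1) / 2) - 1) * i) = 1 + (q - 1) * l) ∧
    (∀ i : ℕ, 1 ≤ i → i ≤ q ^ ((m - 1) / 2) →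
      wtq q (q ^ (m - 1) + (q ^ ((m - 1) / 2) - 1) * i) = 1 + (q - 1) * ((m - 1) / 2)) ∧
    (∀ l i : ℕ, (m + 1) / 2 ≤ l → l ≤ m - 1 → i ≤ (q - 1) * q ^ (m - 1 - l) - 1 →
      wtq q (q ^ m - (q - 1) * q ^ (m - 1 - l) - (q ^ ((m + 1) / 2) - 1) * i)
        = 1 + (q - 1) * l) := by
  obtain ⟨k, rfl⟩ := hmo
  have hq2 : 2 ≤ q := by omega
  have hq0 : 0 < q := by omega
  have e1 : (2 * k + 1 + 1) / 2 = k + 1 := by omega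
  have e2 : (2 * k + 1 - 1) / 2 = k := by omega
  have e3 : 2 * k + 1 - 1 = 2 * k := by omega
  rw [e1, e2, e3]
  have hh1 : 1 ≤ q ^ (k + 1) := Nat.one_le_pow _ _ hq0
  refine ⟨fun l i hl hi => ?_, fun i hi hi' => ?_, fun l i hl hl' hi => ?_⟩
  · have hpos : 0 < q ^ l := by positivity
    have hle : q * q ^ l ≤ q ^ (k + 1) := by
      rw [← pow_succ']
      exact Nat.pow_le_pow_right hq0 (by omega)
    have hle' : 2 * q ^ l ≤ q * q ^ l := Nat.mul_le_mul_right _ hq2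
    obtain ⟨c, hc⟩ := Nat.exists_eq_add_of_le hi
    have hN : 2 * q ^ l - 1 + (q ^ (k + 1) - 1) * i = c + q ^ (k + 1) * i := by
      rw [hc]
      zify [hh1]
      ring
    have := wtq_add_wtq_of_add_eq hq2 hq2 l c i (by omega)
    rw [hN, wtq_add_pow_mul hq2 _ _ _ (by omega)]
    omega
  · have hk1 : 1 ≤ q ^ k := Nat.one_le_pow _ _ hq0
    obtain ⟨c, rfl⟩ := Nat.exists_eq_add_of_le' hi
    obtain ⟨d, hd⟩ := Nat.exists_eq_add_of_le hi'
    have hN : q ^ (2 * k) + (q ^ k - 1) * (c + 1) = d + q ^ k * (c + q ^ k * 1) := by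
      zify [hk1] at hd ⊢
      rw [two_mul, pow_add]
      linear_combination hd
    have := wtq_add_wtq_of_add_eq hq2 (by omega : 1 ≤ q) k c d (by omega)
    rw [hN, wtq_add_pow_mul hq2 _ _ _ (by omega), wtq_add_pow_mul hq2 _ _ _ (by omega),
      wtq_of_lt hq2 (by omega : 1 < q)]
    omega
  · obtain ⟨e, he⟩ := Nat.exists_eq_add_of_le hl'
    have hel : 2 * k - l = e := by omega
    rw [hel] at hi ⊢
    have hpos : 0 < (q - 1) * q ^ e := Nat.mul_pos (by omega) (by positivity)
    have hle : (q - 1) * q ^ e ≤ q ^ k :=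
      calc (q - 1) * q ^ e ≤ q * q ^ e := Nat.mul_le_mul_right _ (by omega)
        _ = q ^ (e + 1) := (pow_succ' q e).symm
        _ ≤ q ^ k := Nat.pow_le_pow_right hq0 (by omega)
    have hle' : q ^ k ≤ q ^ (k + 1) := Nat.pow_le_pow_right hq0 (by omega)
    obtain ⟨c, hc⟩ := Nat.exists_eq_add_of_lt (show i < (q - 1) * q ^ e by omega)
    obtain ⟨u, hu⟩ := Nat.exists_eq_add_of_lt (show i < q ^ k by omega)
    obtain ⟨v, hv⟩ := Nat.exists_eq_add_of_lt (show c < q ^ (k + 1) by omega)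
    have hN : q ^ (2 * k + 1) - (q - 1) * q ^ e - (q ^ (k + 1) - 1) * i
        = v + q ^ (k + 1) * u := by
      have : q ^ (2 * k + 1) =
          v + q ^ (k + 1) * u + (q ^ (k + 1) - 1) * i + (q - 1) * q ^ e := by
        rw [hc, show 2 * k + 1 = (k + 1) + k by ring, pow_add]
        zify [hh1] at hu hv ⊢
        linear_combination (q : ℤ) ^ (k + 1) * hu + hv
      omega
    have h1 := wtq_add_wtq_of_add_eq hq2 (by omega : q - 1 ≤ q) e c i (by omega)
    have h2 := wtq_add_wtq_of_add_eq hq2 (by omega : 1 ≤ q) k u i (by omega)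
    have h3 := wtq_add_wtq_of_add_eq hq2 (by omega : 1 ≤ q) (k + 1) v c (by omega)
    rw [hN, wtq_add_pow_mul hq2 _ _ _ (by omega)]
    have h4 : (q - 1) * k + (q - 1) * k = (q - 1) * l + (q - 1) * e := by
      rw [← mul_add, ← mul_add, ← he, two_mul]
    rw [mul_add, mul_one] at h3
    omega
end
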